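/- Assume the p-adic Schanuel Conjecture. Then Leopoldt's Conjecture holds for M: rk((log_p(σ_i(g_j(ε))))_{σ_i ∈ E_p, g_j ∈ G}) = r, the ℤ-rank of O_M^*. -/

import Mathlib

open scoped NumberField
open Filter

/-- The `p`-adic logarithm on a complete normed field `Cp` (a stand-in for `ℂ_p`), defined by
the power series `log_p x = ∑_{k ≥ 1} (-1)^(k+1) (x-1)^k / k` (convergent for `‖x - 1‖ < 1`). -/
noncomputable def plog (Cp : Type*) [NormedField Cp] (x : Cp) : Cp :=
  ∑' k : ℕ, (-1) ^ (k + 1 + 1) * (x - 1) ^ (k + 1) / ((k : Cp) + 1)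

/-- The `p`-adic Schanuel conjecture. -/
def PadicSchanuel (Cp : Type*) [NormedField Cp] [CharZero Cp] : Prop :=
  ∀ (m : ℕ) (α : Fin m → Cp),
    (∀ i, IsAlgebraic ℚ (α i)) → (∀ i, ‖α i - 1‖ < 1) →
    LinearIndependent ℚ (fun i => plog Cp (α i)) →
    AlgebraicIndependent ℚ (fun i => plog Cp (α i))

/-- The matrix `(log_p (σ (g ε)))` with rows indexed by `S_p ⊆ E_p` and columns by `G`. -/
noncomputable def padicLogMatrix (Cp : Type*) [NormedField Cp] (M : Type*) [Field M]
    [NumberField M] (S : Set (M →+* Cp)) (ε : M) : Matrix S (M ≃ₐ[ℚ] M) Cp :=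
  fun σ g => plog Cp (σ.1 (g ε))

/-- `ε ∈ O_M^*` is a weak Minkowski unit: the subgroup of `(𝓞 M)ˣ` generated by
`{g ε : g ∈ Gal(M/ℚ)}` has finite index in `(𝓞 M)ˣ`. -/
def IsWeakMinkowskiUnit (M : Type*) [Field M] [NumberField M] (ε : (𝓞 M)ˣ) : Prop :=
  ∃ u : (M ≃ₐ[ℚ] M) → (𝓞 M)ˣ,
    (∀ g, algebraMap (𝓞 M) M (u g) = g (algebraMap (𝓞 M) M ε)) ∧
    (Subgroup.closure (Set.range u)).FiniteIndex

/-- The predicate that `(u ^ p ^ n - 1) / p ^ n` tends to `l`. -/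
def HasLog {K : Type*} [NormedField K] (p : ℕ) (u l : K) : Prop :=
  Tendsto (fun n : ℕ => (u ^ p ^ n - 1) / (p : K) ^ n) atTop (nhds l)

section Log

variable {K : Type*} [NormedField K] {p : ℕ}

theorem HasLog.unique {u l l' : K} (h : HasLog p u l) (h' : HasLog p u l') : l = l' :=
  tendsto_nhds_unique h h'

theorem hasLog_one : HasLog p (1 : K) 0 := by
  simp [HasLog]

variable [CharZero K]

theorem HasLog.tendsto_pow (hp0 : p ≠ 0) (hp : ‖(p : K)‖ < 1) {u l : K} (h : HasLog p u l) :
    Tendsto (fun n : ℕ => u ^ p ^ n) atTop (nhds 1) := by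
  have h1 := (tendsto_pow_atTop_nhds_zero_of_norm_lt_one hp).mul h
  have h2 := h1.add_const 1
  simp only [zero_mul, zero_add] at h2
  refine h2.congr fun n => ?_
  have : (p : K) ^ n ≠ 0 := pow_ne_zero _ (Nat.cast_ne_zero.2 hp0)
  field_simp
  ring

theorem HasLog.mul (hp0 : p ≠ 0) (hp : ‖(p : K)‖ < 1) {u v a b : K}
    (hu : HasLog p u a) (hv : HasLog p v b) : HasLog p (u * v) (a + b) := by
  have h := (Tendsto.mul hu (hv.tendsto_pow hp0 hp)).add hv
  rw [mul_one] at h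
  refine h.congr fun n => ?_
  rw [mul_pow]
  ring

theorem HasLog.inv (hp0 : p ≠ 0) (hp : ‖(p : K)‖ < 1) {u a : K} (hu0 : u ≠ 0)
    (hu : HasLog p u a) : HasLog p u⁻¹ (-a) := by
  have h := (Tendsto.mul hu ((hu.tendsto_pow hp0 hp).inv₀ one_ne_zero)).neg
  rw [inv_one, mul_one] at h
  refine h.congr fun n => ?_
  rw [inv_pow]
  have : u ^ p ^ n ≠ 0 := pow_ne_zero _ hu0
  field_simp
  ring

theorem HasLog.pow (hp0 : p ≠ 0) (hp : ‖(p : K)‖ < 1) {u a : K} (hu : HasLog p u a) (m : ℕ) :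
    HasLog p (u ^ m) (m * a) := by
  induction m with
  | zero => simpa using hasLog_one
  | succ m ih =>
    rw [pow_succ, Nat.cast_succ, add_mul, one_mul]
    exact ih.mul hp0 hp hu

theorem HasLog.zpow (hp0 : p ≠ 0) (hp : ‖(p : K)‖ < 1) {u a : K} (hu0 : u ≠ 0)
    (hu : HasLog p u a) (m : ℤ) : HasLog p (u ^ m) (m * a) := by
  obtain ⟨k, rfl | rfl⟩ := m.eq_nat_or_neg
  · simpa using hu.pow hp0 hp k
  · simpa using (hu.pow hp0 hp k).inv hp0 hp (pow_ne_zero _ hu0)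

theorem HasLog.prod_zpow (hp0 : p ≠ 0) (hp : ‖(p : K)‖ < 1) {ι : Type*} (s : Finset ι)
    {u a : ι → K} (hu0 : ∀ i, u i ≠ 0) (hu : ∀ i, HasLog p (u i) (a i)) (m : ι → ℤ) :
    HasLog p (∏ i ∈ s, u i ^ m i) (∑ i ∈ s, m i * a i) := by
  classical
  induction s using Finset.induction_on with
  | empty => simpa using hasLog_one
  | insert i s hi ih =>
    rw [Finset.prod_insert hi, Finset.sum_insert hi]
    exact ((hu i).zpow hp0 hp (hu0 i) _).mul hp0 hp ih

theorem tendsto_choose_prime_pow_sub_one (hp0 : p ≠ 0) (hp : ‖(p : K)‖ < 1) (k : ℕ) :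
    Tendsto (fun n : ℕ => ((p ^ n - 1).choose k : K)) atTop (nhds ((-1) ^ k)) := by
  induction k with
  | zero => simp
  | succ k ih =>
    have h := ih.mul
      (((tendsto_pow_atTop_nhds_zero_of_norm_lt_one hp).div_const ((k : K) + 1)).sub_const 1)
    rw [zero_div, zero_sub, ← pow_succ] at h
    refine h.congr fun n => ?_
    have hq : 1 ≤ p ^ n := Nat.one_le_pow _ _ (Nat.pos_of_ne_zero hp0)
    obtain ⟨q, hq⟩ := Nat.exists_eq_add_of_le' hq
    have hk : (k : K) + 1 ≠ 0 := Nat.cast_add_one_ne_zero k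
    have h1 : ((q : K) + 1) * q.choose k = (q.choose k + q.choose (k + 1)) * (k + 1) := by
      have := Nat.add_one_mul_choose_eq q k
      rw [Nat.choose_succ_succ'] at this
      exact_mod_cast this
    rw [← Nat.cast_pow, hq, Nat.add_sub_cancel]
    push_cast
    field_simp
    linear_combination h1

theorem summable_succ_mul_pow {t : ℝ} (h0 : 0 ≤ t) (h1 : t < 1) :
    Summable fun k : ℕ => ((k : ℝ) + 1) * t ^ (k + 1) := by
  have := (summable_nat_add_iff 1).2
    (summable_pow_mul_geometric_of_norm_lt_one 1 (r := t) (by rwa [Real.norm_of_nonneg h0]))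
  simpa using this

theorem norm_pow_div_le (hlow : ∀ n : ℕ, 1 ≤ (n + 1 : ℝ) * ‖((n : K) + 1)‖) (x : K) (k : ℕ) :
    ‖x ^ (k + 1) / ((k : K) + 1)‖ ≤ ((k : ℝ) + 1) * ‖x‖ ^ (k + 1) := by
  have h0 : (0 : ℝ) < ‖((k : K) + 1)‖ := norm_pos_iff.2 (Nat.cast_add_one_ne_zero k)
  rw [norm_div, norm_pow, div_le_iff₀ h0]
  nlinarith [mul_le_mul_of_nonneg_right (hlow k) (pow_nonneg (norm_nonneg x) (k + 1))]

theorem hasLog_plog [CompleteSpace K] (hp0 : p ≠ 0) (hp : ‖(p : K)‖ < 1)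
    (hnat : ∀ n : ℕ, ‖(n : K)‖ ≤ 1) (hlow : ∀ n : ℕ, 1 ≤ (n + 1 : ℝ) * ‖((n : K) + 1)‖)
    {u : K} (hu : ‖u - 1‖ < 1) : HasLog p u (plog K u) := by
  have key := tendsto_tsum_of_dominated_convergence (𝓕 := atTop)
    (f := fun n k : ℕ => ((p ^ n - 1).choose k : K) * ((u - 1) ^ (k + 1) / ((k : K) + 1)))
    (g := fun k => (-1) ^ k * ((u - 1) ^ (k + 1) / ((k : K) + 1)))
    (summable_succ_mul_pow (norm_nonneg (u - 1)) hu)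
    (fun k => (tendsto_choose_prime_pow_sub_one hp0 hp k).mul_const _)
    (Eventually.of_forall fun n k => by
      rw [norm_mul]
      exact (mul_le_of_le_one_left (norm_nonneg _) (hnat _)).trans (norm_pow_div_le hlow _ _))
  have hl : plog K u = ∑' k : ℕ, (-1) ^ k * ((u - 1) ^ (k + 1) / ((k : K) + 1)) := by
    refine tsum_congr fun k => ?_
    ring
  rw [HasLog, hl]
  refine key.congr fun n => ?_
  have hq : 1 ≤ p ^ n := Nat.one_le_pow _ _ (Nat.pos_of_ne_zero hp0)
  obtain ⟨q, hq⟩ := Nat.exists_eq_add_of_le' hq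
  have hq0 : (q : K) + 1 ≠ 0 := Nat.cast_add_one_ne_zero q
  rw [← Nat.cast_pow, hq, Nat.add_sub_cancel, tsum_eq_sum (s := Finset.range (q + 1))]
  · have hb : u ^ (q + 1) = ((u - 1) + 1) ^ (q + 1) := by rw [sub_add_cancel]
    rw [hb, add_pow, Finset.sum_range_succ' _ (q + 1)]
    simp only [one_pow, mul_one, pow_zero, Nat.choose_zero_right, Nat.cast_one,
      add_sub_cancel_right, Finset.sum_div]
    refine Finset.sum_congr rfl fun k _ => ?_
    have hk : (k : K) + 1 ≠ 0 := Nat.cast_add_one_ne_zero k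
    have h1 : ((q : K) + 1) * q.choose k = (q + 1).choose (k + 1) * (k + 1) := by
      exact_mod_cast Nat.add_one_mul_choose_eq q k
    push_cast
    field_simp
    linear_combination (u - 1) ^ (k + 1) * h1
  · intro k hk
    rw [Finset.mem_range, not_lt] at hk
    rw [Nat.choose_eq_zero_of_lt (by omega)]
    simp

theorem exists_plog_eq_zero_imp [CompleteSpace K]
    (hlow : ∀ n : ℕ, 1 ≤ (n + 1 : ℝ) * ‖((n : K) + 1)‖) :
    ∃ δ > 0, ∀ u : K, ‖u - 1‖ < δ → plog K u = 0 → u = 1 := by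
  have hsum : Summable fun k : ℕ => ((k : ℝ) + 2) * (1 / 2) ^ k := by
    have h1 := summable_pow_mul_geometric_of_norm_lt_one 1 (r := (1 / 2 : ℝ)) (by norm_num)
    have h2 := (summable_geometric_of_lt_one (r := (1 / 2 : ℝ)) (by norm_num)
      (by norm_num)).mul_left 2
    refine (h1.add h2).congr fun k => ?_
    ring
  set C : ℝ := ∑' k : ℕ, ((k : ℝ) + 2) * (1 / 2) ^ k with hC
  have hC0 : 0 ≤ C := tsum_nonneg fun k => by positivity
  refine ⟨min (1 / 2) (1 / (C + 1)), by positivity, fun u hu h0 => ?_⟩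
  obtain ⟨hu1, hu2⟩ := lt_min_iff.1 hu
  set x := u - 1 with hx
  set f : ℕ → K := fun k => (-1) ^ (k + 1 + 1) * x ^ (k + 1) / ((k : K) + 1) with hf
  have hfn : ∀ k, ‖f k‖ ≤ ((k : ℝ) + 1) * ‖x‖ ^ (k + 1) := fun k => by
    rw [hf]
    simp only [mul_div_assoc, norm_mul, norm_pow, norm_neg, norm_one, one_pow, one_mul]
    simpa only [norm_div, norm_pow] using norm_pow_div_le hlow x k
  have hfs : Summable f := Summable.of_norm_bounded
    (summable_succ_mul_pow (norm_nonneg x) (by linarith)) hfn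
  have hsplit : plog K u = x + ∑' k, f (k + 1) := by
    have := hfs.tsum_eq_zero_add
    simpa [hf, plog] using this
  have htail : ‖∑' k, f (k + 1)‖ ≤ C * ‖x‖ ^ 2 := by
    refine tsum_of_norm_bounded (hsum.hasSum.mul_right _) fun k => (hfn (k + 1)).trans ?_
    have : ‖x‖ ^ k ≤ (1 / 2) ^ k := pow_le_pow_left₀ (norm_nonneg x) hu1.le k
    push_cast
    calc ((k : ℝ) + 1 + 1) * ‖x‖ ^ (k + 1 + 1) = ((k : ℝ) + 2) * ‖x‖ ^ k * ‖x‖ ^ 2 := by ring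
      _ ≤ _ := by gcongr
  have hxn : ‖x‖ ≤ C * ‖x‖ ^ 2 := by
    have : x = -∑' k, f (k + 1) := by
      rw [h0] at hsplit
      exact eq_neg_of_add_eq_zero_left hsplit.symm
    calc ‖x‖ = ‖∑' k, f (k + 1)‖ := (congrArg norm this).trans (norm_neg _)
      _ ≤ _ := htail
  by_contra hne
  have hpos : 0 < ‖x‖ := norm_pos_iff.2 (sub_ne_zero.2 hne)
  rw [lt_div_iff₀ (by positivity)] at hu2
  nlinarith

theorem HasLog.exists_pow_eq_one [CompleteSpace K] (hp0 : p ≠ 0) (hp : ‖(p : K)‖ < 1)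
    (hnat : ∀ n : ℕ, ‖(n : K)‖ ≤ 1) (hlow : ∀ n : ℕ, 1 ≤ (n + 1 : ℝ) * ‖((n : K) + 1)‖)
    {u : K} (h : HasLog p u 0) : ∃ m : ℕ, 0 < m ∧ u ^ m = 1 := by
  obtain ⟨δ, hδ, hδu⟩ := exists_plog_eq_zero_imp (K := K) hlow
  obtain ⟨n, hn⟩ := (Metric.tendsto_atTop.1 (h.tendsto_pow hp0 hp) (min δ 1)
    (by positivity))
  have hn := hn n le_rfl
  rw [dist_eq_norm, lt_min_iff] at hn
  refine ⟨p ^ n, pow_pos (Nat.pos_of_ne_zero hp0) n, hδu _ hn.1 ?_⟩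
  have h1 := h.pow hp0 hp (p ^ n)
  rw [mul_zero] at h1
  exact (hasLog_plog hp0 hp hnat hlow hn.2).unique h1

theorem HasLog.eq_zero_of_pow_eq_one (hp0 : p ≠ 0) (hp : ‖(p : K)‖ < 1)
    {u l : K} (h : HasLog p u l) {m : ℕ} (hm : 0 < m) (hum : u ^ m = 1) : l = 0 := by
  have h1 := h.pow hp0 hp m
  rw [hum] at h1
  simpa [hm.ne'] using h1.unique hasLog_one

end Log

section LinearAlgebra

/-- A subspace of functions on a finite group that is stable under left translation is the
annihilator of all translates of a single function. -/
theorem exists_mem_iff_translate_dotProduct {G : Type*} [Group G] [Fintype G]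
    (R : Submodule ℚ (G → ℚ)) (hR : ∀ a ∈ R, ∀ h : G, (fun g => a (h⁻¹ * g)) ∈ R) :
    ∃ f : G → ℚ, ∀ a : G → ℚ, a ∈ R ↔ ∀ h : G, ∑ g, a g * f (h * g) = 0 := by
  classical
  let B : LinearMap.BilinForm ℚ (G → ℚ) := dotProductBilin ℚ ℚ
  have hB : ∀ v w : G → ℚ, B v w = ∑ g, v g * w g := fun v w => rfl
  have hrefl : B.IsRefl := fun v w h => by
    rw [hB] at h ⊢
    simpa only [mul_comm] using h
  have hcompl : IsCompl R (B.orthogonal R) := by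
    rw [LinearMap.BilinForm.isCompl_orthogonal_iff_disjoint hrefl, Submodule.disjoint_def]
    intro x hx hx'
    have h0 : ∑ g, x g * x g = 0 := hx' x hx
    rw [Finset.sum_eq_zero_iff_of_nonneg fun g _ => mul_self_nonneg _] at h0
    exact funext fun g => mul_self_eq_zero.1 (h0 g (Finset.mem_univ g))
  have hdec : ∀ v : G → ℚ, ∃ r ∈ R, ∃ w : G → ℚ, (∀ a ∈ R, ∑ g, a g * w g = 0) ∧ r + w = v := by
    intro v
    obtain ⟨r, hr, w, hw, h⟩ := Submodule.mem_sup.1 (hcompl.sup_eq_top ▸ Submodule.mem_top (x := v))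
    exact ⟨r, hr, w, fun a ha => hw a ha, h⟩
  obtain ⟨r, hr, f, hf, hrf⟩ := hdec (Pi.single 1 1)
  have hann : ∀ a ∈ R, ∀ h : G, ∑ g, a g * f (h * g) = 0 := by
    intro a ha h
    rw [← hf _ (hR a ha h), ← Equiv.sum_comp (Equiv.mulLeft h) fun g => a (h⁻¹ * g) * f g]
    simp
  refine ⟨f, fun a => ⟨hann a, fun ha => ?_⟩⟩
  obtain ⟨s, hs, w, hw, rfl⟩ := hdec a
  suffices w = 0 by simpa [this] using hs
  funext h
  have h1 : ∑ g, w g * f (h⁻¹ * g) = 0 := by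
    have := ha h⁻¹
    simp only [Pi.add_apply, add_mul, Finset.sum_add_distrib] at this
    rwa [hann s hs, zero_add] at this
  have h2 := hw _ (hR r hr h)
  have h3 : ∀ g, r (h⁻¹ * g) + f (h⁻¹ * g) = if g = h then 1 else 0 := fun g => by
    have := congrFun hrf (h⁻¹ * g)
    rw [Pi.add_apply, Pi.single_apply] at this
    simpa only [inv_mul_eq_one, eq_comm] using this
  have h4 : ∑ g, w g * (r (h⁻¹ * g) + f (h⁻¹ * g)) = 0 := by
    simp only [mul_add, Finset.sum_add_distrib, h1, add_zero]
    simpa only [mul_comm] using h2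
  simpa [h3] using h4

/-- If a family of vectors whose coordinates are linear forms with rational coefficients becomes
linearly independent at a rational point, then it is linearly independent at every algebraically
independent point. -/
theorem linearIndependent_of_algebraicIndependent {K H J : Type*} [Field K] [Algebra ℚ K]
    [Fintype H] [Fintype J] (c : H → J → J → ℚ) {x : J → K} (hx : AlgebraicIndependent ℚ x)
    (y : J → ℚ) (hy : LinearIndependent ℚ fun (j : J) (h : H) => ∑ k, c h j k * y k) :
    LinearIndependent K fun (j : J) (h : H) => ∑ k, algebraMap ℚ K (c h j k) * x k := by
  classical
  let X : Matrix H J (MvPolynomial J ℚ) :=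
    fun h j => ∑ k, MvPolynomial.C (c h j k) * MvPolynomial.X k
  let N : Matrix H J ℚ := fun h j => ∑ k, c h j k * y k
  have hNinj : Function.Injective N.mulVec := by
    rw [Matrix.mulVec_injective_iff]
    exact hy
  obtain ⟨P, hP⟩ : ∃ P : Matrix J H ℚ, P * N = 1 := by
    obtain ⟨g, hg⟩ := (Matrix.toLin' N).exists_leftInverse_of_injective
      (LinearMap.ker_eq_bot.2 hNinj)
    refine ⟨LinearMap.toMatrix' g, ?_⟩
    have := congrArg LinearMap.toMatrix' hg
    rwa [LinearMap.toMatrix'_comp, LinearMap.toMatrix'_toLin', LinearMap.toMatrix'_id] at this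
  let P' : Matrix J H (MvPolynomial J ℚ) := P.map MvPolynomial.C
  let Q : Matrix J J (MvPolynomial J ℚ) := P' * X
  let D : MvPolynomial J ℚ := Q.det
  have hDy : MvPolynomial.eval y D = 1 := by
    change MvPolynomial.eval y Q.det = 1
    rw [RingHom.map_det, ← Matrix.det_one (n := J) (R := ℚ), ← hP]
    congr 1
    ext i j
    simp only [Q, RingHom.mapMatrix_apply, Matrix.map_apply, Matrix.mul_apply]
    simp [P', X, N]
  have hDx : MvPolynomial.aeval x D ≠ 0 := by
    intro h0
    have := (injective_iff_map_eq_zero _).1 (algebraicIndependent_iff_injective_aeval.1 hx) D h0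
    simp [this] at hDy
  let A : Matrix H J K := fun h j => ∑ k, algebraMap ℚ K (c h j k) * x k
  have hPA : (P.map (algebraMap ℚ K) * A).det ≠ 0 := by
    convert hDx
    change _ = MvPolynomial.aeval x Q.det
    rw [AlgHom.map_det]
    congr 1
    ext i j
    simp only [Q, AlgHom.mapMatrix_apply, Matrix.map_apply, Matrix.mul_apply]
    simp [P', X, A]
  change LinearIndependent K A.col
  rw [← Matrix.mulVec_injective_iff]
  have h1 : Function.Injective (P.map (algebraMap ℚ K) * A).mulVec :=
    Matrix.mulVec_injective_of_isUnit ((Matrix.isUnit_iff_isUnit_det _).2 hPA.isUnit)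
  intro v w hvw
  apply h1
  simp only [← Matrix.mulVec_mulVec, hvw]

theorem linearIndependent_translates {G K J : Type*} [Group G] [Fintype G] [Fintype J] [Field K]
    [Algebra ℚ K] (L : G → K) (i : J → G) (hi : AlgebraicIndependent ℚ (L ∘ i))
    (hspan : ∀ g, L g ∈ Submodule.span ℚ (Set.range (L ∘ i)))
    (hL : ∀ a : G → ℚ, ∑ g, a g • L g = 0 → ∀ h, ∑ g, a g • L (h * g) = 0) :
    LinearIndependent K fun (j : J) (h : G) => L (h * i j) := by
  classical
  let φ : (G → ℚ) →ₗ[ℚ] K := Fintype.linearCombination ℚ L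
  have hφ : ∀ a, φ a = ∑ g, a g • L g := fun a => Fintype.linearCombination_apply ..
  obtain ⟨f, hf⟩ := exists_mem_iff_translate_dotProduct (LinearMap.ker φ) (fun a ha h => by
    rw [LinearMap.mem_ker, hφ] at ha ⊢
    rw [← hL a ha h, ← Equiv.sum_comp (Equiv.mulLeft h)]
    simp)
  choose c hc using fun g => (Submodule.mem_span_range_iff_exists_fun ℚ).1 (hspan g)
  have hinj : Function.Injective i := fun j k hjk =>
    hi.injective (by simp [hjk])
  have hLc : ∀ (h : G) (j : J), L (h * i j) = ∑ k, algebraMap ℚ K (c (h * i j) k) * L (i k) :=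
    fun h j => by
      rw [← hc (h * i j)]
      simp [Algebra.smul_def]
  have hext : ∀ (b : J → ℚ) (F : G → ℚ),
      ∑ g, (∑ k, Pi.single (M := fun _ => ℚ) (i k) (b k) g) * F g = ∑ k, b k * F (i k) := by
    intro b F
    simp_rw [Finset.sum_mul]
    rw [Finset.sum_comm]
    simp [Pi.single_apply]
  have hextL : ∀ (b : J → ℚ),
      φ (∑ k, Pi.single (i k) (b k)) = ∑ k, b k • L (i k) := by
    intro b
    simp [φ, map_sum]
  have hfc : ∀ g, f g = ∑ k, c g k * f (i k) := fun g => by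
    have hmem : Pi.single g 1 - ∑ k, Pi.single (i k) (c g k) ∈ LinearMap.ker φ := by
      rw [LinearMap.mem_ker, map_sub, hextL, sub_eq_zero]
      simpa [φ] using (hc g).symm
    have := (hf _).1 hmem 1
    simp only [Pi.sub_apply, Finset.sum_apply, sub_mul, Finset.sum_sub_distrib, hext,
      one_mul] at this
    simpa [sub_eq_zero, Pi.single_apply] using this
  simp_rw [hLc]
  refine linearIndependent_of_algebraicIndependent (fun h j => c (h * i j)) hi (f ∘ i) ?_
  simp only [Function.comp_apply, ← hfc]
  rw [Fintype.linearIndependent_iff]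
  intro b hb
  have hmem : (∑ k, Pi.single (i k) (b k)) ∈ LinearMap.ker φ := by
    rw [hf]
    intro h
    have := congrFun hb h
    simp only [Finset.sum_apply, Pi.smul_apply, smul_eq_mul, Pi.zero_apply] at this
    simp only [Finset.sum_apply, hext b fun g => f (h * g), this]
  rw [LinearMap.mem_ker, hextL] at hmem
  exact Fintype.linearIndependent_iff.1 hi.linearIndependent b hmem

theorem mem_span_range_comp_of_relations {k ι J V W : Type*} [Field k] [Fintype ι]
    [AddCommGroup V] [Module k V] [AddCommGroup W] [Module k W] {x : ι → V} {y : ι → W}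
    (h : ∀ a : ι → k, ∑ g, a g • x g = 0 → ∑ g, a g • y g = 0) (i : J → ι) {g : ι}
    (hg : x g ∈ Submodule.span k (Set.range (x ∘ i))) :
    y g ∈ Submodule.span k (Set.range (y ∘ i)) := by
  classical
  let φ := Fintype.linearCombination k x
  let ψ := Fintype.linearCombination k y
  let s : ι → ι → k := fun j => Pi.single j 1
  have hx : x = φ ∘ s := funext fun j => by simp [φ, s]
  have hy : y = ψ ∘ s := funext fun j => by simp [ψ, s]
  rw [hx, Function.comp_assoc, Set.range_comp φ, ← Submodule.map_span] at hg
  obtain ⟨b, hb, hbg⟩ := hg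
  rw [hy, Function.comp_assoc, Set.range_comp ψ, ← Submodule.map_span]
  refine ⟨b, hb, ?_⟩
  rw [Function.comp_apply, ← sub_eq_zero, ← map_sub]
  apply h
  change φ _ = 0
  rw [map_sub, hbg, Function.comp_apply, sub_self]

theorem sum_zsmul_eq_smul_sum {ι V : Type*} [Fintype ι] [AddCommGroup V] [Module ℚ V]
    (x : ι → V) {a : ι → ℚ} {b : ι → ℤ} {c : ℚ} (hb : ∀ g, (b g : ℚ) = c * a g) :
    ∑ g, b g • x g = c • ∑ g, a g • x g := by
  rw [Finset.smul_sum]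
  refine Finset.sum_congr rfl fun g _ => ?_
  rw [← Int.cast_smul_eq_zsmul ℚ, hb, mul_smul]

theorem sum_rat_smul_eq_zero_of_int {ι V W : Type*} [Fintype ι] [AddCommGroup V] [Module ℚ V]
    [AddCommGroup W] [Module ℚ W] {x : ι → V} {y : ι → W}
    (h : ∀ a : ι → ℤ, ∑ g, a g • x g = 0 → ∑ g, a g • y g = 0) (a : ι → ℚ)
    (ha : ∑ g, a g • x g = 0) : ∑ g, a g • y g = 0 := by
  obtain ⟨n, hn⟩ := IsLocalization.exist_integer_multiples_of_finite (nonZeroDivisors ℤ) a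
  choose b hb using hn
  have hn0 : ((n : ℤ) : ℚ) ≠ 0 := Int.cast_ne_zero.2 (nonZeroDivisors.coe_ne_zero n)
  have hb' : ∀ g, (b g : ℚ) = (n : ℤ) * a g := fun g => by simpa using hb g
  have h1 := h b (by rw [sum_zsmul_eq_smul_sum _ hb', ha, smul_zero])
  rw [sum_zsmul_eq_smul_sum _ hb'] at h1
  exact (smul_eq_zero.1 h1).resolve_left hn0

theorem finrank_span_rat_eq_finrank_span_int {ι V : Type*} [Finite ι] [AddCommGroup V]
    [Module ℚ V] (x : ι → V) :
    Module.finrank ℚ (Submodule.span ℚ (Set.range x)) =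
      Module.finrank ℤ (Submodule.span ℤ (Set.range x)) := by
  have : Module.Finite ℤ (Submodule.span ℤ (Set.range x)) :=
    Module.Finite.span_of_finite ℤ (Set.finite_range x)
  have : Module.IsTorsionFree ℤ V := .trans_faithfulSMul ℤ ℚ V
  let b := Module.finBasis ℤ (Submodule.span ℤ (Set.range x))
  let v := fun k => (b k : V)
  have hv : LinearIndependent ℤ v := b.linearIndependent.map' (Submodule.subtype _) (by simp)
  rw [LinearIndependent.iff_fractionRing ℤ ℚ] at hv
  have hspan : Submodule.span ℤ (Set.range v) = Submodule.span ℤ (Set.range x) := by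
    have := congrArg (Submodule.map (Submodule.subtype _)) b.span_eq
    rwa [Submodule.map_span, ← Set.range_comp, Submodule.map_subtype_top] at this
  rw [← Submodule.span_span_of_tower ℤ ℚ (Set.range x), ← hspan, Submodule.span_span_of_tower,
    finrank_span_eq_card hv, Fintype.card_fin, hspan]

end LinearAlgebra

section Units

open NumberField

variable {K : Type*} [NormedField K] [CharZero K] [CompleteSpace K] {p : ℕ}
  {M : Type*} [Field M] {ι : Type*} [Fintype ι]

theorem sum_plog_eq_zero_iff (hp0 : p ≠ 0) (hp : ‖(p : K)‖ < 1)
    (hnat : ∀ n : ℕ, ‖(n : K)‖ ≤ 1) (hlow : ∀ n : ℕ, 1 ≤ (n + 1 : ℝ) * ‖((n : K) + 1)‖)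
    (σ : M →+* K) (u : ι → (𝓞 M)ˣ) (hu : ∀ i, ‖σ (algebraMap (𝓞 M) M (u i)) - 1‖ < 1)
    (a : ι → ℤ) :
    ∑ i, a i • plog K (σ (algebraMap (𝓞 M) M (u i))) = 0 ↔
      ∏ i, u i ^ a i ∈ Units.torsion M := by
  let τ : (𝓞 M)ˣ →* Kˣ := Units.map (σ.comp (algebraMap (𝓞 M) M)).toMonoidHom
  have hτ : Function.Injective τ := Units.map_injective
    (σ.injective.comp (FaithfulSMul.algebraMap_injective (𝓞 M) M))
  have hcoe : ((τ (∏ i, u i ^ a i) : Kˣ) : K) =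
      ∏ i, σ (algebraMap (𝓞 M) M (u i)) ^ a i := by
    simp [τ]
  have hlog : HasLog p ((τ (∏ i, u i ^ a i) : Kˣ) : K)
      (∑ i, a i • plog K (σ (algebraMap (𝓞 M) M (u i)))) := by
    simp only [hcoe, zsmul_eq_mul]
    exact HasLog.prod_zpow hp0 hp _ (fun i => (τ (u i)).ne_zero)
      (fun i => hasLog_plog hp0 hp hnat hlow (hu i)) a
  rw [Units.torsion, CommGroup.mem_torsion, isOfFinOrder_iff_pow_eq_one]
  constructor
  · intro h0
    rw [h0] at hlog
    obtain ⟨m, hm, h1⟩ := hlog.exists_pow_eq_one hp0 hp hnat hlow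
    refine ⟨m, hm, hτ ?_⟩
    rw [map_pow, map_one]
    exact Units.ext h1
  · rintro ⟨m, hm, h1⟩
    refine hlog.eq_zero_of_pow_eq_one hp0 hp hm ?_
    rw [← Units.val_pow_eq_pow_val, ← map_pow, h1, map_one, Units.val_one]

theorem finrank_span_plog [NumberField M] (hp0 : p ≠ 0) (hp : ‖(p : K)‖ < 1)
    (hnat : ∀ n : ℕ, ‖(n : K)‖ ≤ 1) (hlow : ∀ n : ℕ, 1 ≤ (n + 1 : ℝ) * ‖((n : K) + 1)‖)
    (σ : M →+* K) (u : ι → (𝓞 M)ˣ) (hu : ∀ i, ‖σ (algebraMap (𝓞 M) M (u i)) - 1‖ < 1)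
    (hfin : (Subgroup.closure (Set.range u)).FiniteIndex) :
    Module.finrank ℚ
      (Submodule.span ℚ (Set.range fun i => plog K (σ (algebraMap (𝓞 M) M (u i))))) =
      Units.rank M := by
  classical
  let L : ι → K := fun i => plog K (σ (algebraMap (𝓞 M) M (u i)))
  let φ : (ι → ℤ) →ₗ[ℤ] K := Fintype.linearCombination ℤ L
  let ψ : (ι → ℤ) →ₗ[ℤ] Units.dirichletUnitTheorem.logSpace M :=
    Fintype.linearCombination ℤ fun i => Units.logEmbedding M (Additive.ofMul (u i))
  have hψ : ∀ a, ψ a = Units.logEmbedding M (Additive.ofMul (∏ i, u i ^ a i)) := fun a => by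
    simp [ψ, Fintype.linearCombination_apply, ofMul_prod]
  have hker : LinearMap.ker φ = LinearMap.ker ψ := by
    ext a
    rw [LinearMap.mem_ker, LinearMap.mem_ker, hψ,
      Units.dirichletUnitTheorem.logEmbedding_eq_zero_iff,
      ← sum_plog_eq_zero_iff hp0 hp hnat hlow σ u hu a]
    simp [φ, L, Fintype.linearCombination_apply]
  have hrange : Module.finrank ℤ (LinearMap.range φ) = Module.finrank ℤ (LinearMap.range ψ) :=
    (φ.quotKerEquivRange.symm.trans
      ((Submodule.quotEquivOfEq _ _ hker).trans ψ.quotKerEquivRange)).finrank_eq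
  have hφ : LinearMap.range φ = Submodule.span ℤ (Set.range L) :=
    Fintype.range_linearCombination ..
  change Module.finrank ℚ (Submodule.span ℚ (Set.range L)) = _
  rw [finrank_span_rat_eq_finrank_span_int, ← hφ, hrange, ← Units.unitLattice_rank]
  have hle : LinearMap.range ψ ≤ Units.unitLattice M := by
    rintro _ ⟨a, rfl⟩
    rw [hψ]
    exact ⟨Additive.ofMul (∏ i, u i ^ a i), trivial, rfl⟩
  have : Module.Finite ℤ (Units.unitLattice M) := ZLattice.module_finite ℝ _
  refine le_antisymm
    (LinearMap.finrank_le_finrank_of_injective (Submodule.inclusion_injective hle)) ?_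
  set m := (Subgroup.closure (Set.range u)).index
  have hm0 : m ≠ 0 := hfin.index_ne_zero
  have hmem : ∀ x ∈ Units.unitLattice M, (m : ℤ) • x ∈ LinearMap.range ψ := by
    rintro _ ⟨y, -, rfl⟩
    obtain ⟨a, ha⟩ := Subgroup.exists_of_mem_closure_range u _
      ((Subgroup.closure (Set.range u)).pow_index_mem y.toMul)
    refine ⟨a, ?_⟩
    rw [hψ, ← ha, ofMul_pow, map_nsmul, natCast_zsmul]
    rfl
  let μ : Units.unitLattice M →ₗ[ℤ] LinearMap.range ψ :=
    LinearMap.codRestrict _ ((m : ℤ) • (Units.unitLattice M).subtype) fun x => hmem x x.2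
  refine LinearMap.finrank_le_finrank_of_injective (f := μ) fun x y hxy => ?_
  have h1 : (m : ℤ) • (x : Units.dirichletUnitTheorem.logSpace M) = (m : ℤ) • (y : _) :=
    congrArg Subtype.val hxy
  exact Subtype.ext (smul_right_injective _ (Int.natCast_ne_zero.2 hm0) h1)

end Units

theorem one_le_succ_mul_padic_norm (p : ℕ) [Fact p.Prime] (n : ℕ) :
    1 ≤ (n + 1 : ℝ) * ‖((n : ℚ_[p]) + 1)‖ := by
  have hp : (0 : ℝ) < p := by exact_mod_cast (Fact.out : p.Prime).pos
  have h0 : ((n + 1 : ℕ) : ℚ_[p]) ≠ 0 := Nat.cast_ne_zero.2 n.succ_ne_zero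
  have h1 : p ^ padicValNat p (n + 1) ≤ n + 1 := Nat.le_of_dvd n.succ_pos pow_padicValNat_dvd
  rw [← Nat.cast_add_one (R := ℚ_[p]), Padic.norm_eq_zpow_neg_valuation h0, Padic.valuation_natCast,
    zpow_neg, zpow_natCast, ← div_eq_mul_inv, one_le_div (by positivity)]
  exact_mod_cast h1

/-- The `p`-adic Schanuel conjecture implies Leopoldt's conjecture for `M`:
the rank of the matrix `(log_p (σ (g ε)))`, with rows indexed by all of `E_p` and columns
by `G`, equals the `ℤ`-rank `r` of the unit group `O_M^*`. -/
theorem stmt1 (p : ℕ) [Fact p.Prime]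
    (Cp : Type*) [NormedField Cp] [CompleteSpace Cp] [IsAlgClosed Cp] [CharZero Cp]
    [Algebra ℚ_[p] Cp] (hpadic : ∀ x : ℚ_[p], ‖algebraMap ℚ_[p] Cp x‖ = ‖x‖)
    (hiso : Nonempty (Cp ≃+* ℂ))
    (M : Type*) [Field M] [NumberField M] [IsGalois ℚ M]
    (ε : (𝓞 M)ˣ) (hWM : IsWeakMinkowskiUnit M ε)
    (hloc : ∀ (σ : M →+* Cp) (g : M ≃ₐ[ℚ] M), ‖σ (g (algebraMap (𝓞 M) M ε)) - 1‖ < 1)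
    (hSch : PadicSchanuel Cp) :
    (padicLogMatrix Cp M (Set.univ : Set (M →+* Cp)) (algebraMap (𝓞 M) M ε)).rank =
      NumberField.Units.rank M := by
  classical
  have hcast : ∀ n : ℕ, ‖(n : Cp)‖ = ‖(n : ℚ_[p])‖ := fun n => by
    rw [← hpadic, map_natCast]
  have hp0 : p ≠ 0 := (Fact.out : p.Prime).ne_zero
  have hp : ‖(p : Cp)‖ < 1 := by
    rw [hcast]
    exact Padic.norm_p_lt_one
  have hnat : ∀ n : ℕ, ‖(n : Cp)‖ ≤ 1 := fun n => by
    rw [hcast]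
    exact_mod_cast Padic.norm_int_le_one (n : ℤ)
  have hlow : ∀ n : ℕ, 1 ≤ (n + 1 : ℝ) * ‖((n : Cp) + 1)‖ := fun n => by
    have := one_le_succ_mul_padic_norm p n
    rwa [← Nat.cast_add_one (R := ℚ_[p]), ← hcast, Nat.cast_add_one (R := Cp)] at this
  obtain ⟨u, hu, hfin⟩ := hWM
  let l : (M →+* Cp) → (M ≃ₐ[ℚ] M) → Cp := fun σ g => plog Cp (σ (g (algebraMap (𝓞 M) M ε)))
  have hu1 : ∀ (σ : M →+* Cp) g, ‖σ (algebraMap (𝓞 M) M (u g)) - 1‖ < 1 := fun σ g => by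
    rw [hu]
    exact hloc σ g
  have hrel : ∀ (σ τ : M →+* Cp) (a : (M ≃ₐ[ℚ] M) → ℚ),
      ∑ g, a g • l σ g = 0 → ∑ g, a g • l τ g = 0 := by
    intro σ τ
    refine sum_rat_smul_eq_zero_of_int fun a ha => ?_
    simp only [l, ← hu] at ha ⊢
    rw [sum_plog_eq_zero_iff hp0 hp hnat hlow _ u (hu1 _)] at ha ⊢
    exact ha
  let σ₀ : M →+* Cp := (IsAlgClosed.lift (R := ℚ) : M →ₐ[ℚ] Cp).toRingHom
  obtain ⟨κ, i, hi, hspan, hind⟩ := exists_linearIndependent' ℚ (l σ₀)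
  have : Finite κ := Finite.of_injective i hi
  obtain ⟨m, ⟨e⟩⟩ := Finite.exists_equiv_fin κ
  have hrange : Set.range (l σ₀ ∘ (i ∘ e.symm)) = Set.range (l σ₀ ∘ i) := by
    rw [← Function.comp_assoc, e.symm.surjective.range_comp]
  have hind' : LinearIndependent ℚ (l σ₀ ∘ (i ∘ e.symm)) := by
    rw [← Function.comp_assoc]
    exact hind.comp _ e.symm.injective
  have halg : AlgebraicIndependent ℚ (l σ₀ ∘ (i ∘ e.symm)) :=
    hSch m (fun j => σ₀ (i (e.symm j) (algebraMap (𝓞 M) M ε)))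
      (fun j => IsAlgebraic.algHom σ₀.toRatAlgHom (Algebra.IsAlgebraic.isAlgebraic _))
      (fun j => hloc σ₀ _) hind'
  have hmem : ∀ g, l σ₀ g ∈ Submodule.span ℚ (Set.range (l σ₀ ∘ (i ∘ e.symm))) := fun g => by
    rw [hrange, hspan]
    exact Submodule.subset_span (Set.mem_range_self g)
  have htrans := linearIndependent_translates (l σ₀) (i ∘ e.symm) halg hmem
    fun a ha h => hrel σ₀ (σ₀.comp (h : M →+* M)) a ha
  let A := padicLogMatrix Cp M (Set.univ : Set (M →+* Cp)) (algebraMap (𝓞 M) M ε)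
  have hcols : LinearIndependent Cp (A.col ∘ (i ∘ e.symm)) :=
    .of_comp (LinearMap.funLeft Cp Cp fun h : M ≃ₐ[ℚ] M =>
      (⟨σ₀.comp (h : M →+* M), Set.mem_univ _⟩ : (Set.univ : Set (M →+* Cp)))) htrans
  have hcolspan : Submodule.span Cp (Set.range A.col) =
      Submodule.span Cp (Set.range (A.col ∘ (i ∘ e.symm))) := by
    refine le_antisymm (Submodule.span_le.2 ?_)
      (Submodule.span_mono (Set.range_comp_subset_range _ _))
    rintro _ ⟨g, rfl⟩
    refine Submodule.span_subset_span ℚ Cp _ (mem_span_range_comp_of_relations ?_ _ (hmem g))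
    intro a ha
    funext τ
    simpa using! hrel σ₀ τ.1 a ha
  change A.rank = _
  rw [A.rank_eq_finrank_span_cols, hcolspan, finrank_span_eq_card hcols,
    ← finrank_span_eq_card hind', hrange, hspan,
    ← finrank_span_plog hp0 hp hnat hlow σ₀ u (hu1 σ₀) hfin]
  have hl : l σ₀ = fun g => plog Cp (σ₀ (algebraMap (𝓞 M) M (u g))) :=
    funext fun g => by rw [hu]
  rw [hl]
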